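/- arXiv:1011.3100 — 2 statements merged into one kernel-verified Lean document; each statement's English description precedes it below -/
import Mathlib

section
/- Let (X, X', X'') be three consecutive steps of a reversible Markov chain in equilibrium, with W = W(X), W' = W(X'), W'' = W(X'') integer-valued. Define Q_m(x) = P(W' = W+m | X = x), q_m = E Q_m(X), and Q_{m₁,m₂}(x) = P(W' = W + m₁, W'' = W' + m₂ | X = x). Then for every positive integer m with q_m > 0: D_{2,m}(ℒ(W)) ≤ q_m^{−2} [2 Var Q_m(X) + E|Q_{m,m}(X) − Q_m(X)²| + 2 Var Q_{−m}(X) + E|Q_{−m,−m}(X) − Q_{−m}(X)²|]. -/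
open MeasureTheory ProbabilityTheory Filter

noncomputable section

/-- Forward difference operator with step `m`. -/
def fd (m : ℤ) (f : ℤ → ℝ) : ℤ → ℝ := fun j => f (j + m) - f j

/-- The smoothness functional `D_{n,m}` of a law `ν` on `ℤ`. -/
def Dnm (n m : ℕ) (ν : Measure ℤ) : ℝ :=
  sSup {x | ∃ g : ℤ → ℝ, (∀ i, |g i| ≤ 1) ∧ x = |∫ i, (fd m)^[n] g i ∂ν|}

/-- Integrating a conditional expectation against a measurable weight. -/
theorem integral_condExp_mul_eq {Ω : Type*} {m m0 : MeasurableSpace Ω} {μ : Measure Ω}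
    [IsFiniteMeasure μ] (hm : m ≤ m0) {u v : Ω → ℝ} (hu : Integrable u μ)
    (hv : StronglyMeasurable[m] v) (huv : Integrable (u * v) μ) :
    ∫ ω, (μ[u | m]) ω * v ω ∂μ = ∫ ω, u ω * v ω ∂μ := by
  have h := condExp_mul_of_stronglyMeasurable_right hv huv hu
  calc ∫ ω, (μ[u | m]) ω * v ω ∂μ = ∫ ω, (μ[u * v | m]) ω ∂μ := (integral_congr_ae h).symm
    _ = ∫ ω, u ω * v ω ∂μ := integral_condExp hm

/-- The conditional probability of an event about `(X, Y)` given `X`, written as a function of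
`X`, only depends on the joint law of `(X, Y)`. -/
theorem condExp_preimage_eq_comp_of_identDistrib {Ω α β : Type*} [MeasurableSpace Ω]
    [MeasurableSpace α] [MeasurableSpace β] {μ : Measure Ω} [IsProbabilityMeasure μ]
    {X X' : Ω → α} {Y Y' : Ω → β} (hX : Measurable X) (hX' : Measurable X')
    (hY : Measurable Y) (hY' : Measurable Y')
    (hlaw : μ.map (fun ω => (X ω, Y ω)) = μ.map (fun ω => (X' ω, Y' ω)))
    {s : Set (α × β)} (hs : MeasurableSet s) {φ : α → ℝ} (hφ : Measurable φ)
    (h : μ⟦{ω | (X ω, Y ω) ∈ s} | MeasurableSpace.comap X inferInstance⟧ = φ ∘ X) :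
    μ⟦{ω | (X' ω, Y' ω) ∈ s} | MeasurableSpace.comap X' inferInstance⟧ =ᵐ[μ] φ ∘ X' := by
  have hid : IdentDistrib (fun ω => (X ω, Y ω)) (fun ω => (X' ω, Y' ω)) μ μ :=
    ⟨(hX.prodMk hY).aemeasurable, (hX'.prodMk hY').aemeasurable, hlaw⟩
  have hint : Integrable (φ ∘ X) μ := h ▸ integrable_condExp
  have hint' : Integrable (φ ∘ X') μ :=
    (hid.comp (hφ.comp measurable_fst)).integrable_iff.1 hint
  have hA : MeasurableSet {ω | (X ω, Y ω) ∈ s} := (hX.prodMk hY) hs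
  have hA' : MeasurableSet {ω | (X' ω, Y' ω) ∈ s} := (hX'.prodMk hY') hs
  refine (ae_eq_condExp_of_forall_setIntegral_eq hX'.comap_le
    ((integrable_const _).indicator hA') (fun _ _ _ => hint'.integrableOn) ?_
    (hφ.comp (comap_measurable X')).aestronglyMeasurable).symm
  rintro _ ⟨t, ht, rfl⟩ -
  have h1 := setIntegral_condExp (μ := μ) hX.comap_le
    (((integrable_const (1 : ℝ)).indicator hA)) (⟨t, ht, rfl⟩ :
      MeasurableSet[MeasurableSpace.comap X inferInstance] (X ⁻¹' t))
  rw [h] at h1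
  rw [← integral_indicator (hX ht), ← integral_indicator (hX ht)] at h1
  rw [← integral_indicator (hX' ht), ← integral_indicator (hX' ht)]
  have h2 := (hid.comp ((hφ.comp measurable_fst).indicator
    (measurable_fst (β := β) ht))).integral_eq
  have h3 := (hid.comp (((measurable_const (a := (1 : ℝ))).indicator hs).indicator
    (measurable_fst (β := β) ht))).integral_eq
  exact h2.symm.trans (h1.trans h3)

/-- Given the middle state, the two one-step increments of an integer-valued functional
are conditionally independent. -/
theorem condExp_two_step_eq_mul {Ω α : Type*} [MeasurableSpace Ω] [StandardBorelSpace Ω]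
    [MeasurableSpace α] {μ : Measure Ω} [IsProbabilityMeasure μ]
    {X X' X'' : Ω → α} (hX : Measurable X) (hX' : Measurable X') (hX'' : Measurable X'')
    (hm' : MeasurableSpace.comap X' inferInstance ≤ ‹MeasurableSpace Ω›)
    (hMarkov : CondIndepFun (MeasurableSpace.comap X' inferInstance) hm' X X'' μ)
    {f : α → ℤ} (hf : Measurable f) (k l : ℤ) :
    μ⟦{ω | f (X' ω) = f (X ω) + k ∧ f (X'' ω) = f (X' ω) + l} |
        MeasurableSpace.comap X' inferInstance⟧ =ᵐ[μ]
      fun ω => (μ⟦{ω | f (X' ω) = f (X ω) + k} | MeasurableSpace.comap X' inferInstance⟧) ω *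
        (μ⟦{ω | f (X'' ω) = f (X' ω) + l} | MeasurableSpace.comap X' inferInstance⟧) ω := by
  have hW := hf.comp hX
  have hW' := hf.comp hX'
  have hW'' := hf.comp hX''
  have hA : MeasurableSet {ω | f (X' ω) = f (X ω) + k} :=
    measurableSet_eq_fun hW' (hW.add_const k)
  have hB : MeasurableSet {ω | f (X'' ω) = f (X' ω) + l} :=
    measurableSet_eq_fun hW'' (hW'.add_const l)
  have hmid (j : ℤ) : MeasurableSet[MeasurableSpace.comap X' inferInstance]
      {ω | f (X' ω) = j} := ⟨f ⁻¹' {j}, hf (measurableSet_singleton j), rfl⟩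
  have key (j : ℤ) := (condIndepFun_iff_condExp_inter_preimage_eq_mul hX hX'').1 hMarkov
    (f ⁻¹' {j - k}) (f ⁻¹' {j + l}) (hf (measurableSet_singleton _))
    (hf (measurableSet_singleton _))
  have loc (s t : Set Ω) (hs : MeasurableSet s) (ht : MeasurableSet t) (j : ℤ)
      (hst : ∀ ω, f (X' ω) = j → (ω ∈ s ↔ ω ∈ t)) :
      ∀ᵐ ω ∂μ, f (X' ω) = j → (μ⟦s | MeasurableSpace.comap X' inferInstance⟧) ω =
        (μ⟦t | MeasurableSpace.comap X' inferInstance⟧) ω := by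
    have e1 := condExp_indicator ((integrable_const (μ := μ) (1 : ℝ)).indicator hs) (hmid j)
    have e2 := condExp_indicator ((integrable_const (μ := μ) (1 : ℝ)).indicator ht) (hmid j)
    have e : {ω | f (X' ω) = j}.indicator (s.indicator (fun _ => (1 : ℝ))) =
        {ω | f (X' ω) = j}.indicator (t.indicator (fun _ => (1 : ℝ))) := by
      classical
      ext ω
      by_cases h : f (X' ω) = j
      · simp [Set.indicator_apply, h, hst ω h]
      · simp [h]
    rw [e] at e1
    filter_upwards [e1, e2] with ω h1 h2 h
    simpa [Set.indicator_apply, h] using h1.symm.trans h2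
  have hall : ∀ᵐ ω ∂μ, ∀ j : ℤ, f (X' ω) = j →
      (μ⟦{ω | f (X' ω) = f (X ω) + k ∧ f (X'' ω) = f (X' ω) + l} |
        MeasurableSpace.comap X' inferInstance⟧) ω =
      (μ⟦{ω | f (X' ω) = f (X ω) + k} | MeasurableSpace.comap X' inferInstance⟧) ω *
        (μ⟦{ω | f (X'' ω) = f (X' ω) + l} | MeasurableSpace.comap X' inferInstance⟧) ω := by
    refine ae_all_iff.2 fun j => ?_
    have hs : MeasurableSet (X ⁻¹' (f ⁻¹' {j - k})) := hW (measurableSet_singleton _)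
    have ht : MeasurableSet (X'' ⁻¹' (f ⁻¹' {j + l})) := hW'' (measurableSet_singleton _)
    filter_upwards [key j, loc _ _ hA hs j (by simp; omega), loc _ _ hB ht j (by simp; omega),
      loc _ _ (hA.inter hB) (hs.inter ht) j (by simp; omega)] with ω h1 h2 h3 h4 h
    rw [h2 h, h3 h, ← h1, ← h4 h]
    rfl
  filter_upwards [hall] with ω h
  exact h _ rfl

theorem integrable_indicator_one_mul {Ω : Type*} [MeasurableSpace Ω] {μ : Measure Ω}
    [IsFiniteMeasure μ] {s : Set Ω} (hs : MeasurableSet s) {v : Ω → ℝ}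
    (hv : Integrable v μ) : Integrable (s.indicator (fun _ => (1 : ℝ)) * v) μ := by
  have : s.indicator (fun _ => (1 : ℝ)) * v = s.indicator v := by
    ext ω; by_cases h : ω ∈ s <;> simp [h]
  exact this ▸ hv.indicator hs

theorem integrable_comp_of_abs_le {Ω : Type*} [MeasurableSpace Ω] {μ : Measure Ω}
    [IsFiniteMeasure μ] {W : Ω → ℤ} (hW : Measurable W) {h : ℤ → ℝ} (hb : ∀ i, |h i| ≤ 1) :
    Integrable (fun ω => h (W ω)) μ :=
  .of_bound ((measurable_of_countable h).comp hW).aestronglyMeasurable 1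
    (.of_forall fun ω => hb (W ω))

theorem integral_condExp_increment_mul {Ω α : Type*} [MeasurableSpace Ω]
    [MeasurableSpace α] {μ : Measure Ω} [IsProbabilityMeasure μ]
    {X X' : Ω → α} (hX : Measurable X) (hX' : Measurable X')
    (hrev : μ.map (fun ω => (X ω, X' ω)) = μ.map (fun ω => (X' ω, X ω)))
    {f : α → ℤ} (hf : Measurable f) {h : ℤ → ℝ} (hb : ∀ i, |h i| ≤ 1) (k : ℤ) :
    ∫ ω, (μ⟦{ω | f (X' ω) = f (X ω) + k} | MeasurableSpace.comap X inferInstance⟧) ω *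
        h (f (X ω) + k) ∂μ =
      ∫ ω, (μ⟦{ω | f (X' ω) = f (X ω) + -k} | MeasurableSpace.comap X inferInstance⟧) ω *
        h (f (X ω)) ∂μ := by
  have hmeas (j : ℤ) : MeasurableSet {ω | f (X' ω) = f (X ω) + j} :=
    measurableSet_eq_fun (hf.comp hX') ((hf.comp hX).add_const j)
  have hpull (j i : ℤ) := integral_condExp_mul_eq (μ := μ) hX.comap_le
    ((integrable_const (1 : ℝ)).indicator (hmeas j))
    (v := fun ω => h (f (X ω) + i))
    ((measurable_of_countable fun n : ℤ => h (n + i)).comp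
      (hf.comp (comap_measurable X))).stronglyMeasurable
    (integrable_indicator_one_mul (hmeas j)
      (integrable_comp_of_abs_le (hf.comp hX) (h := fun n => h (n + i)) fun _ => hb _))
  have h0 := hpull (-k) 0
  simp only [add_zero] at h0
  rw [hpull k k, h0]
  have hid : IdentDistrib (fun ω => (X ω, X' ω)) (fun ω => (X' ω, X ω)) μ μ :=
    ⟨(hX.prodMk hX').aemeasurable, (hX'.prodMk hX).aemeasurable, hrev⟩
  have hs : MeasurableSet {p : α × α | f p.2 = f p.1 + k} :=
    measurableSet_eq_fun (hf.comp measurable_snd) ((hf.comp measurable_fst).add_const k)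
  have hF : Measurable fun p : α × α => {p : α × α | f p.2 = f p.1 + k}.indicator
      (fun _ => (1 : ℝ)) p * h (f p.1 + k) :=
    (measurable_const.indicator hs).mul
      ((measurable_of_countable fun n : ℤ => h (n + k)).comp (hf.comp measurable_fst))
  refine (hid.comp hF).integral_eq.trans (integral_congr_ae (.of_forall fun ω => ?_))
  by_cases hc : f (X ω) = f (X' ω) + k
  · simp [Set.indicator_apply, hc]
  · have hc' : f (X' ω) ≠ f (X ω) + -k := by omega
    simp [Set.indicator_apply, hc, hc']

theorem integral_condExp_two_step_mul {Ω α : Type*} [MeasurableSpace Ω] [StandardBorelSpace Ω]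
    [MeasurableSpace α] {μ : Measure Ω} [IsProbabilityMeasure μ]
    {X X' X'' : Ω → α} (hX : Measurable X) (hX' : Measurable X') (hX'' : Measurable X'')
    (hrev : μ.map (fun ω => (X ω, X' ω)) = μ.map (fun ω => (X' ω, X ω)))
    (hstat : μ.map (fun ω => (X ω, X' ω)) = μ.map (fun ω => (X' ω, X'' ω)))
    (hm' : MeasurableSpace.comap X' inferInstance ≤ ‹MeasurableSpace Ω›)
    (hMarkov : CondIndepFun (MeasurableSpace.comap X' inferInstance) hm' X X'' μ)
    {f : α → ℤ} (hf : Measurable f) {h : ℤ → ℝ} (hb : ∀ i, |h i| ≤ 1) (k : ℤ) :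
    ∫ ω, (μ⟦{ω | f (X' ω) = f (X ω) + k ∧ f (X'' ω) = f (X' ω) + k} |
        MeasurableSpace.comap X inferInstance⟧) ω * h (f (X ω) + k) ∂μ =
      ∫ ω, (μ⟦{ω | f (X' ω) = f (X ω) + k} | MeasurableSpace.comap X inferInstance⟧) ω *
        (μ⟦{ω | f (X' ω) = f (X ω) + -k} | MeasurableSpace.comap X inferInstance⟧) ω *
        h (f (X ω)) ∂μ := by
  have hA : MeasurableSet {ω | f (X' ω) = f (X ω) + k} :=
    measurableSet_eq_fun (hf.comp hX') ((hf.comp hX).add_const k)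
  have hB : MeasurableSet {ω | f (X'' ω) = f (X' ω) + k} :=
    measurableSet_eq_fun (hf.comp hX'') ((hf.comp hX').add_const k)
  have hAB : MeasurableSet {ω | f (X' ω) = f (X ω) + k ∧ f (X'' ω) = f (X' ω) + k} :=
    hA.inter hB
  have hs (j : ℤ) : MeasurableSet {p : α × α | f p.2 = f p.1 + j} :=
    measurableSet_eq_fun (hf.comp measurable_snd) ((hf.comp measurable_fst).add_const j)
  have hfactor (j : ℤ) : ∃ φ : α → ℝ, Measurable φ ∧
      μ⟦{ω | f (X' ω) = f (X ω) + j} | MeasurableSpace.comap X inferInstance⟧ = φ ∘ X := by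
    obtain ⟨φ, h1, h2⟩ := StronglyMeasurable.exists_eq_measurable_comp
      (stronglyMeasurable_condExp (m := MeasurableSpace.comap X inferInstance) (μ := μ)
        (f := {ω | f (X' ω) = f (X ω) + j}.indicator (fun _ => (1 : ℝ))))
    exact ⟨φ, h1.measurable, h2⟩
  obtain ⟨φ, hφ, hφX⟩ := hfactor k
  obtain ⟨ψ, hψ, hψX⟩ := hfactor (-k)
  have hforward := condExp_preimage_eq_comp_of_identDistrib hX hX' hX' hX'' hstat (hs k) hφ hφX
  have hbackward := condExp_preimage_eq_comp_of_identDistrib hX hX' hX' hX hrev (hs (-k)) hψ hψX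
  have hset : {ω | (X' ω, X ω) ∈ {p : α × α | f p.2 = f p.1 + -k}} =
      {ω | f (X' ω) = f (X ω) + k} := by
    ext ω; simp only [Set.mem_ofPred_eq]; omega
  rw [hset] at hbackward
  have hid : IdentDistrib (fun ω => (X ω, X' ω)) (fun ω => (X' ω, X ω)) μ μ :=
    ⟨(hX.prodMk hX').aemeasurable, (hX'.prodMk hX).aemeasurable, hrev⟩
  have hF : Measurable fun p : α × α => φ p.1 * ψ p.1 * h (f p.1) :=
    ((hφ.comp measurable_fst).mul (hψ.comp measurable_fst)).mul
      ((measurable_of_countable h).comp (hf.comp measurable_fst))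
  calc _ = ∫ ω, {ω | f (X' ω) = f (X ω) + k ∧ f (X'' ω) = f (X' ω) + k}.indicator
          (fun _ => (1 : ℝ)) ω * h (f (X ω) + k) ∂μ :=
        integral_condExp_mul_eq hX.comap_le ((integrable_const (1 : ℝ)).indicator hAB)
          (v := fun ω => h (f (X ω) + k))
          ((measurable_of_countable fun n : ℤ => h (n + k)).comp
            (hf.comp (comap_measurable X))).stronglyMeasurable
          (integrable_indicator_one_mul hAB
            (integrable_comp_of_abs_le (hf.comp hX) (h := fun n => h (n + k)) fun _ => hb _))
    _ = ∫ ω, {ω | f (X' ω) = f (X ω) + k ∧ f (X'' ω) = f (X' ω) + k}.indicator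
          (fun _ => (1 : ℝ)) ω * h (f (X' ω)) ∂μ := by
        refine integral_congr_ae (.of_forall fun ω => ?_)
        by_cases hc : f (X' ω) = f (X ω) + k <;> simp [Set.indicator_apply, hc]
    _ = ∫ ω, (μ⟦{ω | f (X' ω) = f (X ω) + k ∧ f (X'' ω) = f (X' ω) + k} |
          MeasurableSpace.comap X' inferInstance⟧) ω * h (f (X' ω)) ∂μ :=
        (integral_condExp_mul_eq hX'.comap_le ((integrable_const (1 : ℝ)).indicator hAB)
          (v := fun ω => h (f (X' ω)))
          ((measurable_of_countable h).comp
            (hf.comp (comap_measurable X'))).stronglyMeasurable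
          (integrable_indicator_one_mul hAB
            (integrable_comp_of_abs_le (hf.comp hX') hb))).symm
    _ = ∫ ω, φ (X' ω) * ψ (X' ω) * h (f (X' ω)) ∂μ := by
        refine integral_congr_ae ?_
        filter_upwards [condExp_two_step_eq_mul hX hX' hX'' hm' hMarkov hf k k, hforward,
          hbackward] with ω h1 h2 h3
        simp only [Function.comp_apply] at h1 h2 h3
        rw [h1, h2, h3, mul_comm (ψ _)]
    _ = ∫ ω, φ (X ω) * ψ (X ω) * h (f (X ω)) ∂μ := (hid.comp hF).integral_eq.symm
    _ = _ := by rw [hφX, hψX]; rfl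

theorem abs_condExp_indicator_one_le {Ω : Type*} {m m0 : MeasurableSpace Ω} {μ : Measure Ω}
    (s : Set Ω) : ∀ᵐ ω ∂μ, |(μ⟦s | m⟧) ω| ≤ 1 :=
  ae_bdd_abs_condExp_of_ae_bdd_abs (.of_forall fun ω => by
    by_cases h : ω ∈ s <;> simp [h])

/-- The quadratic estimate behind the second-difference bound: it only uses the integral
identities satisfied by the transition weights `P`, `N` and their two-step versions. -/
theorem abs_integral_second_difference_le {Ω : Type*} [MeasurableSpace Ω] {μ : Measure Ω}
    [IsProbabilityMeasure μ] {P N PP NN g₀ g₁ g₂ : Ω → ℝ} {q : ℝ}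
    (hP : MemLp P ⊤ μ) (hN : MemLp N ⊤ μ) (hPP : MemLp PP ⊤ μ) (hNN : MemLp NN ⊤ μ)
    (hg₀ : MemLp g₀ ⊤ μ) (hg₁ : MemLp g₁ ⊤ μ) (hg₂ : MemLp g₂ ⊤ μ)
    (hb₀ : ∀ ω, |g₀ ω| ≤ 1) (hb₁ : ∀ ω, |g₁ ω| ≤ 1) (hb₂ : ∀ ω, |g₂ ω| ≤ 1)
    (h₁ : ∫ ω, P ω * g₂ ω ∂μ = ∫ ω, N ω * g₁ ω ∂μ)
    (h₂ : ∫ ω, P ω * g₁ ω ∂μ = ∫ ω, N ω * g₀ ω ∂μ)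
    (h₃ : ∫ ω, PP ω * g₂ ω ∂μ = ∫ ω, P ω * N ω * g₁ ω ∂μ)
    (h₄ : ∫ ω, NN ω * g₀ ω ∂μ = ∫ ω, P ω * N ω * g₁ ω ∂μ) :
    q ^ 2 * |∫ ω, g₂ ω - 2 * g₁ ω + g₀ ω ∂μ| ≤
      2 * ∫ ω, (P ω - q) ^ 2 ∂μ + ∫ ω, |PP ω - P ω ^ 2| ∂μ +
        2 * ∫ ω, (N ω - q) ^ 2 ∂μ + ∫ ω, |NN ω - N ω ^ 2| ∂μ := by
  have mul {u v : Ω → ℝ} (hu : MemLp u ⊤ μ) (hv : MemLp v ⊤ μ) :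
      MemLp (fun ω => u ω * v ω) ⊤ μ := hv.mul hu
  have int {u : Ω → ℝ} (hu : MemLp u ⊤ μ) : Integrable u μ := hu.integrable le_top
  have hsq {u : Ω → ℝ} (hu : MemLp u ⊤ μ) : MemLp (fun ω => u ω ^ 2) ⊤ μ := by
    simpa only [pow_two] using mul hu hu
  have iD : Integrable (fun ω => g₂ ω - 2 * g₁ ω + g₀ ω) μ :=
    ((int hg₂).sub ((int hg₁).const_mul 2)).add (int hg₀)
  have i1 := int (mul hP hg₂)
  have i2 := int (mul hN hg₁)
  have i3 := int (mul hP hg₁)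
  have i4 := int (mul hN hg₀)
  have i5 := int (mul hPP hg₂)
  have i6 := int (mul (mul hP hN) hg₁)
  have i7 := int (mul hNN hg₀)
  have iVP : Integrable (fun ω => (P ω - q) ^ 2) μ := int (hsq (hP.sub (memLp_const q)))
  have iVN : Integrable (fun ω => (N ω - q) ^ 2) μ := int (hsq (hN.sub (memLp_const q)))
  have iA : Integrable (fun ω => |PP ω - P ω ^ 2|) μ := (int (hPP.sub (hsq hP))).abs
  have iB : Integrable (fun ω => |NN ω - N ω ^ 2|) μ := (int (hNN.sub (hsq hN))).abs
  have hS : ∫ ω, (2 * (P ω - q) ^ 2 + |PP ω - P ω ^ 2| +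
      2 * (N ω - q) ^ 2 + |NN ω - N ω ^ 2|) ∂μ = 2 * ∫ ω, (P ω - q) ^ 2 ∂μ +
        ∫ ω, |PP ω - P ω ^ 2| ∂μ + 2 * ∫ ω, (N ω - q) ^ 2 ∂μ + ∫ ω, |NN ω - N ω ^ 2| ∂μ := by
    have j1 : Integrable (fun ω => 2 * (P ω - q) ^ 2 + |PP ω - P ω ^ 2|) μ :=
      (iVP.const_mul 2).add iA
    have j2 : Integrable (fun ω => 2 * (P ω - q) ^ 2 + |PP ω - P ω ^ 2| +
      2 * (N ω - q) ^ 2) μ := j1.add (iVN.const_mul 2)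
    rw [integral_add j2 iB, integral_add j1 (iVN.const_mul 2),
      integral_add (iVP.const_mul 2) iA, integral_const_mul, integral_const_mul]
  have hT : ∫ ω, (q ^ 2 * (g₂ ω - 2 * g₁ ω + g₀ ω) - 2 * q * (P ω * g₂ ω - N ω * g₁ ω) +
      2 * q * (P ω * g₁ ω - N ω * g₀ ω) + (PP ω * g₂ ω - P ω * N ω * g₁ ω) +
      (NN ω * g₀ ω - P ω * N ω * g₁ ω)) ∂μ = q ^ 2 * ∫ ω, g₂ ω - 2 * g₁ ω + g₀ ω ∂μ := by
    have j1 := (iD.const_mul (q ^ 2)).sub ((i1.sub i2).const_mul (2 * q))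
    have j2 := j1.add ((i3.sub i4).const_mul (2 * q))
    have j3 := j2.add (i5.sub i6)
    refine (integral_add j3 (i7.sub i6)).trans ?_
    rw [integral_sub' i7 i6, h₄, sub_self, add_zero]
    refine (integral_add j2 (i5.sub i6)).trans ?_
    rw [integral_sub' i5 i6, h₃, sub_self, add_zero]
    refine (integral_add j1 ((i3.sub i4).const_mul (2 * q))).trans ?_
    rw [integral_const_mul, integral_sub' i3 i4, h₂, sub_self, mul_zero, add_zero]
    refine (integral_sub (iD.const_mul (q ^ 2)) ((i1.sub i2).const_mul (2 * q))).trans ?_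
    rw [integral_const_mul, integral_const_mul, integral_sub' i1 i2, h₁, sub_self, mul_zero,
      sub_zero]
  rw [← hS, ← abs_of_nonneg (sq_nonneg q), ← abs_mul, ← hT]
  have iS : Integrable (fun ω => 2 * (P ω - q) ^ 2 + |PP ω - P ω ^ 2| +
      2 * (N ω - q) ^ 2 + |NN ω - N ω ^ 2|) μ :=
    (((iVP.const_mul 2).add iA).add (iVN.const_mul 2)).add iB
  refine (Real.norm_eq_abs _).symm.le.trans
    (norm_integral_le_of_norm_le iS (.of_forall fun ω => ?_))
  have hid : q ^ 2 * (g₂ ω - 2 * g₁ ω + g₀ ω) - 2 * q * (P ω * g₂ ω - N ω * g₁ ω) +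
      2 * q * (P ω * g₁ ω - N ω * g₀ ω) + (PP ω * g₂ ω - P ω * N ω * g₁ ω) +
      (NN ω * g₀ ω - P ω * N ω * g₁ ω) =
      (P ω - q) ^ 2 * g₂ ω + (PP ω - P ω ^ 2) * g₂ ω + (NN ω - N ω ^ 2) * g₀ ω +
        (N ω - q) ^ 2 * g₀ ω - 2 * ((N ω - q) * (P ω - q)) * g₁ ω := by ring
  rw [hid, Real.norm_eq_abs]
  have bd (a b : ℝ) (hb : |b| ≤ 1) : |a * b| ≤ |a| := by
    rw [abs_mul]; exact mul_le_of_le_one_right (abs_nonneg a) hb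
  have b1 := bd ((P ω - q) ^ 2) _ (hb₂ ω)
  have b2 := bd (PP ω - P ω ^ 2) _ (hb₂ ω)
  have b3 := bd (NN ω - N ω ^ 2) _ (hb₀ ω)
  have b4 := bd ((N ω - q) ^ 2) _ (hb₀ ω)
  have b5 := bd (2 * ((N ω - q) * (P ω - q))) _ (hb₁ ω)
  rw [abs_of_nonneg (sq_nonneg (P ω - q))] at b1
  rw [abs_of_nonneg (sq_nonneg (N ω - q))] at b4
  have b6 : |2 * ((N ω - q) * (P ω - q))| ≤ (N ω - q) ^ 2 + (P ω - q) ^ 2 :=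
    abs_le.2 ⟨by nlinarith [sq_nonneg (N ω - q + (P ω - q))],
      by nlinarith [sq_nonneg (N ω - q - (P ω - q))]⟩
  rw [abs_le] at b1 b2 b3 b4 b5 ⊢
  constructor <;> linarith [b1.1, b1.2, b2.1, b2.2, b3.1, b3.2, b4.1, b4.2, b5.1, b5.2]

/-- Theorem 7: for three consecutive steps `(X,X',X'')` of a stationary reversible
Markov chain (encoded via the distributional identities and the conditional
independence of `X` and `X''` given `X'`), with `W = f(X)` etc.,
`Q_k = P(W' = W + k | X)`, `Q_{k,k} = P(W' = W + k, W'' = W' + k | X)` and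
`q_m = P(W' = W + m) > 0`,
`D_{2,m}(ℒ(W)) ≤ q_m^{−2}(2 Var Q_m + E|Q_{m,m} − Q_m²| + 2 Var Q_{−m} + E|Q_{−m,−m} − Q_{−m}²|)`. -/
theorem D2m_le_reversible_chain
    {Ω α : Type*} [MeasurableSpace Ω] [StandardBorelSpace Ω] [MeasurableSpace α]
    (μ : Measure Ω) [IsProbabilityMeasure μ]
    (X X' X'' : Ω → α) (hX : Measurable X) (hX' : Measurable X') (hX'' : Measurable X'')
    (hrev : μ.map (fun ω => (X ω, X' ω)) = μ.map (fun ω => (X' ω, X ω)))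
    (hrev' : μ.map (fun ω => (X' ω, X'' ω)) = μ.map (fun ω => (X'' ω, X' ω)))
    (hstat : μ.map (fun ω => (X ω, X' ω)) = μ.map (fun ω => (X' ω, X'' ω)))
    (hm' : MeasurableSpace.comap X' inferInstance ≤ ‹MeasurableSpace Ω›)
    (hMarkov : CondIndepFun (MeasurableSpace.comap X' inferInstance) hm' X X'' μ)
    (f : α → ℤ) (hf : Measurable f)
    (Q : ℤ → Ω → ℝ)
    (hQ : ∀ k : ℤ, Q k =
      μ[({ω | f (X' ω) = f (X ω) + k} : Set Ω).indicator (fun _ => (1 : ℝ)) |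
        MeasurableSpace.comap X inferInstance])
    (Q2 : ℤ → Ω → ℝ)
    (hQ2 : ∀ k : ℤ, Q2 k =
      μ[({ω | f (X' ω) = f (X ω) + k ∧ f (X'' ω) = f (X' ω) + k} : Set Ω).indicator
          (fun _ => (1 : ℝ)) | MeasurableSpace.comap X inferInstance])
    (m : ℕ) (hm : 0 < m)
    (q : ℝ) (hq : q = (μ {ω | f (X' ω) = f (X ω) + m}).toReal) (hq0 : 0 < q) :
    Dnm 2 m (μ.map (fun ω => f (X ω)))
      ≤ (2 * variance (Q m) μ + ∫ ω, |Q2 m ω - (Q m ω) ^ 2| ∂μ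
          + 2 * variance (Q (-(m : ℤ))) μ
          + ∫ ω, |Q2 (-(m : ℤ)) ω - (Q (-(m : ℤ)) ω) ^ 2| ∂μ) / q ^ 2 := by
  have hW : Measurable fun ω => f (X ω) := hf.comp hX
  have hQmem (k : ℤ) : MemLp (Q k) ⊤ μ := by
    rw [hQ]
    exact memLp_top_of_bound integrable_condExp.aestronglyMeasurable 1
      (abs_condExp_indicator_one_le _)
  have hQ2mem (k : ℤ) : MemLp (Q2 k) ⊤ μ := by
    rw [hQ2]
    exact memLp_top_of_bound integrable_condExp.aestronglyMeasurable 1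
      (abs_condExp_indicator_one_le _)
  have one_step (h : ℤ → ℝ) (hb : ∀ i, |h i| ≤ 1) (k : ℤ) :
      ∫ ω, Q k ω * h (f (X ω) + k) ∂μ = ∫ ω, Q (-k) ω * h (f (X ω)) ∂μ := by
    rw [hQ, hQ]
    exact integral_condExp_increment_mul hX hX' hrev hf hb k
  have two_step (h : ℤ → ℝ) (hb : ∀ i, |h i| ≤ 1) (k : ℤ) :
      ∫ ω, Q2 k ω * h (f (X ω) + k) ∂μ = ∫ ω, Q k ω * Q (-k) ω * h (f (X ω)) ∂μ := by
    rw [hQ, hQ, hQ2]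
    exact integral_condExp_two_step_mul hX hX' hX'' hrev hstat hm' hMarkov hf hb k
  have hmean : ∫ ω, Q m ω ∂μ = q := by
    have hA : MeasurableSet {ω | f (X' ω) = f (X ω) + m} :=
      measurableSet_eq_fun (hf.comp hX') (hW.add_const _)
    rw [hQ, integral_condExp hX.comap_le, integral_indicator hA, hq]
    simp [Measure.real]
  have hmean' : ∫ ω, Q (-(m : ℤ)) ω ∂μ = q := by
    have := one_step (fun _ => 1) (by simp) m
    simp only [mul_one] at this
    rw [← this, hmean]
  rw [variance_eq_integral (hQmem _).aestronglyMeasurable.aemeasurable,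
    variance_eq_integral (hQmem _).aestronglyMeasurable.aemeasurable, hmean, hmean']
  refine csSup_le ⟨_, fun _ => 0, by simp, rfl⟩ ?_
  rintro _ ⟨g, hg, rfl⟩
  have hmem (i : ℤ) : MemLp (fun ω => g (f (X ω) + i)) ⊤ μ :=
    memLp_top_of_bound ((measurable_of_countable fun n : ℤ => g (n + i)).comp
      hW).aestronglyMeasurable 1 (.of_forall fun _ => hg _)
  have hmap : ∫ i, (fd m)^[2] g i ∂(μ.map fun ω => f (X ω)) =
      ∫ ω, g (f (X ω) + m + m) - 2 * g (f (X ω) + m) + g (f (X ω)) ∂μ := by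
    rw [integral_map hW.aemeasurable (measurable_of_countable _).aestronglyMeasurable]
    refine integral_congr_ae (.of_forall fun ω => ?_)
    simp only [Function.iterate_succ, Function.iterate_zero, Function.comp_apply, id_eq, fd]
    ring
  rw [hmap, le_div_iff₀ (by positivity), mul_comm]
  refine abs_integral_second_difference_le (hQmem _) (hQmem _) (hQ2mem _) (hQ2mem _)
    (by simpa using hmem 0) (hmem m) (by simpa only [add_assoc] using hmem (m + m))
    (fun _ => hg _) (fun _ => hg _) (fun _ => hg _)
    (one_step (fun n => g (n + m)) (fun _ => hg _) m) (one_step g hg m)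
    (two_step (fun n => g (n + m)) (fun _ => hg _) m) ?_
  have := two_step (fun n => g (n + m)) (fun _ => hg _) (-(m : ℤ))
  simp only [neg_add_cancel_right, neg_neg] at this
  rw [this]
  exact integral_congr_ae (.of_forall fun ω => by ring)
end
end

section
/- For fixed k ≥ 1 and m ≥ 1, the smoothness functional of the translated Poisson distribution satisfies D_{k,m}(TP(μ, σ²)) = O(σ^{−k}) as σ → ∞; in particular there exist constants C and σ₀ such that for all σ ≥ σ₀ and all μ ∈ ℝ, D_{k,m}(TP(μ,σ²)) ≤ C σ^{−k}. -/
open MeasureTheory ProbabilityTheory Filter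

noncomputable section

/-- The translated Poisson distribution `TP(μ, σ²)`. -/
def translatedPoisson (μr σ2 : ℝ) : Measure ℤ :=
  (poissonMeasure (Real.toNNReal (σ2 + (μr - σ2 - ⌊μr - σ2⌋)))).map
    (fun k : ℕ => (⌊μr - σ2⌋ + k : ℤ))

open scoped NNReal

namespace PoissonSmoothing

open Real in
/-- The Poisson form of the Stein identity `r * E f(N + 1) = E (N * f N)`. -/
lemma hasSum_poisson_stein {r : ℝ≥0} (hr : 0 < r) {f : ℕ → ℝ} {a : ℝ}
    (h : HasSum (fun n : ℕ => exp (-r) * r ^ n / (n.factorial : ℝ) * f (n + 1)) a) :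
    HasSum (fun n : ℕ => exp (-r) * r ^ n / (n.factorial : ℝ) * (n / r * f n)) a := by
  have hr' : (r : ℝ) ≠ 0 := by exact_mod_cast hr.ne'
  rw [← hasSum_nat_add_iff' 1]
  simp only [Finset.range_one, Finset.sum_singleton, Nat.cast_zero, zero_div, zero_mul, mul_zero,
    sub_zero]
  refine h.congr_fun fun n => ?_
  have h1 : (n.factorial : ℝ) ≠ 0 := by positivity
  have h2 : (n : ℝ) + 1 ≠ 0 := by positivity
  rw [Nat.factorial_succ]
  push_cast
  field_simp
  ring

open Real in
lemma hasSum_poisson_centered_sq {r : ℝ≥0} (hr : 0 < r) :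
    HasSum (fun n : ℕ => exp (-r) * r ^ n / (n.factorial : ℝ) * ((n : ℝ) / r - 1) ^ 2)
      (1 / (r : ℝ)) := by
  have h0 := hasSum_one_poissonMeasure r
  have h1 : HasSum (fun n : ℕ => exp (-r) * r ^ n / (n.factorial : ℝ) * (n / r * 1)) 1 :=
    hasSum_poisson_stein (f := fun _ => 1) hr (by simpa using h0)
  have h2 : HasSum (fun n : ℕ => exp (-r) * r ^ n / (n.factorial : ℝ) * (n / r * (n / r)))
      (1 + 1 / (r : ℝ)) := by
    refine hasSum_poisson_stein (f := fun n => (n : ℝ) / r) hr ?_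
    have h := h1.add (h0.mul_right (1 / (r : ℝ)))
    rw [one_mul] at h
    refine h.congr_fun fun n => ?_
    push_cast
    ring
  have h := (h2.sub (h1.mul_left 2)).add h0
  rw [show 1 + 1 / (r : ℝ) - 2 * 1 + 1 = 1 / r by ring] at h
  refine h.congr_fun fun n => ?_
  ring

lemma integrable_poisson_of_bounded (r : ℝ≥0) {f : ℕ → ℝ} {M : ℝ} (hf : ∀ n, |f n| ≤ M) :
    Integrable f (poissonMeasure r) :=
  Integrable.of_bound .of_discrete M (ae_of_all _ hf)

open Real in
lemma abs_integral_poisson_succ_sub_le {r : ℝ≥0} (hr : 0 < r) {f : ℕ → ℝ} {M : ℝ}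
    (hf : ∀ n, |f n| ≤ M) :
    |∫ n, (f (n + 1) - f n) ∂poissonMeasure r| ≤ M / √r := by
  have hr' : (0 : ℝ) < r := by exact_mod_cast hr
  have hs : 0 < √(r : ℝ) := Real.sqrt_pos.mpr hr'
  have hM : 0 ≤ M := (abs_nonneg _).trans (hf 0)
  have hi0 := integrable_poisson_of_bounded r hf
  have hi1 := integrable_poisson_of_bounded r (f := fun n => f (n + 1)) (fun n => hf (n + 1))
  have h0 := hasSum_integral_poissonMeasure hi0
  have h1 := hasSum_integral_poissonMeasure hi1
  simp only [smul_eq_mul] at h0 h1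
  have hd := (hasSum_poisson_stein hr h1).sub h0
  rw [← integral_sub hi1 hi0] at hd
  have hb := ((((hasSum_poisson_centered_sq hr).mul_right (√(r : ℝ) / 2)).add
    ((hasSum_one_poissonMeasure r).mul_right (1 / (2 * √(r : ℝ)))))).mul_left M
  have hval : M * (1 / (r : ℝ) * (√(r : ℝ) / 2) + 1 * (1 / (2 * √(r : ℝ)))) = M / √r := by
    field_simp
    rw [Real.sq_sqrt hr'.le]
    ring
  rw [hval] at hb
  have key (n : ℕ) : |exp (-r) * r ^ n / (n.factorial : ℝ) * (n / r * f n)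
      - exp (-r) * r ^ n / (n.factorial : ℝ) * f n|
      ≤ M * (exp (-r) * r ^ n / (n.factorial : ℝ) * ((n : ℝ) / r - 1) ^ 2 * (√(r : ℝ) / 2)
        + exp (-r) * r ^ n / (n.factorial : ℝ) * (1 / (2 * √(r : ℝ)))) := by
    set p : ℝ := exp (-r) * r ^ n / (n.factorial : ℝ)
    have hp : 0 ≤ p := by positivity
    set x : ℝ := (n : ℝ) / r - 1 with hx
    have e : p * (n / r * f n) - p * f n = p * (x * f n) := by rw [hx]; ring
    have amgm : |x| ≤ x ^ 2 * (√(r : ℝ) / 2) + 1 / (2 * √(r : ℝ)) := by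
      have : x ^ 2 * (√(r : ℝ) / 2) + 1 / (2 * √(r : ℝ)) - |x|
          = (|x| * √r - 1) ^ 2 / (2 * √r) := by
        rw [← sq_abs x]
        field_simp
        ring
      have : 0 ≤ (|x| * √r - 1) ^ 2 / (2 * √r) := by positivity
      linarith
    rw [e, abs_mul, abs_mul, abs_of_nonneg hp]
    calc p * (|x| * |f n|)
        ≤ p * ((x ^ 2 * (√(r : ℝ) / 2) + 1 / (2 * √(r : ℝ))) * M) := by
          gcongr
          exact hf n
      _ = _ := by ring
  rw [abs_le]
  constructor
  · exact hasSum_le (fun n => neg_le_of_abs_le (key n)) hb.neg hd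
  · exact hasSum_le (fun n => le_of_abs_le (key n)) hd hb

/-- The Poisson averaging operator `g ↦ E g(· + N)`, where `N` is Poisson with mean `r`. -/
def poissonAverage (r : ℝ≥0) (g : ℤ → ℝ) (j : ℤ) : ℝ := ∫ n : ℕ, g (j + n) ∂poissonMeasure r

lemma fd_bounded (m : ℤ) {g : ℤ → ℝ} {M : ℝ} (hg : ∀ i, |g i| ≤ M) (i : ℤ) :
    |fd m g i| ≤ 2 * M := by
  have := (abs_sub (g (i + m)) (g i)).trans (add_le_add (hg (i + m)) (hg i))
  simpa [fd, two_mul] using this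

lemma iterate_fd_bounded (m : ℤ) (k : ℕ) {g : ℤ → ℝ} {M : ℝ} (hg : ∀ i, |g i| ≤ M) (i : ℤ) :
    |(fd m)^[k] g i| ≤ 2 ^ k * M := by
  induction k generalizing g M with
  | zero => simpa using hg i
  | succ k ih =>
    rw [Function.iterate_succ_apply, pow_succ, mul_assoc]
    exact ih (fd_bounded m hg)

lemma poissonAverage_fd (r : ℝ≥0) (m : ℤ) {g : ℤ → ℝ} {M : ℝ} (hg : ∀ i, |g i| ≤ M) :
    poissonAverage r (fd m g) = fd m (poissonAverage r g) := by
  ext j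
  simp only [poissonAverage, fd]
  rw [← integral_sub (integrable_poisson_of_bounded r fun n => hg _)
    (integrable_poisson_of_bounded r fun n => hg _)]
  simp only [add_right_comm]

lemma poissonAverage_iterate_fd (r : ℝ≥0) (m : ℤ) (k : ℕ) {g : ℤ → ℝ} {M : ℝ}
    (hg : ∀ i, |g i| ≤ M) :
    poissonAverage r ((fd m)^[k] g) = (fd m)^[k] (poissonAverage r g) := by
  induction k generalizing g M with
  | zero => rfl
  | succ k ih =>
    rw [Function.iterate_succ_apply, Function.iterate_succ_apply, ih (fd_bounded m hg),
      poissonAverage_fd r m hg]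

lemma poissonAverage_add (r s : ℝ≥0) {g : ℤ → ℝ} {M : ℝ} (hg : ∀ i, |g i| ≤ M) :
    poissonAverage (r + s) g = poissonAverage r (poissonAverage s g) := by
  ext j
  simp only [poissonAverage]
  have hi := integrable_poisson_of_bounded (r + s) (f := fun n : ℕ => g (j + n)) fun n => hg _
  rw [← poissonMeasure_conv_poissonMeasure] at hi ⊢
  rw [integral_conv hi]
  simp only [Nat.cast_add, add_assoc]

lemma abs_poissonAverage_fd_le {r : ℝ≥0} (hr : 0 < r) (m : ℕ) {g : ℤ → ℝ} {M : ℝ}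
    (hg : ∀ i, |g i| ≤ M) (j : ℤ) :
    |poissonAverage r (fd m g) j| ≤ M * (m / √r) := by
  induction m with
  | zero => simp [poissonAverage, fd]
  | succ m ih =>
    have hstep := abs_integral_poisson_succ_sub_le hr (f := fun n : ℕ => g (j + m + n))
      (fun n => hg _)
    have hsplit : poissonAverage r (fd (m + 1 : ℕ) g) j = poissonAverage r (fd m g) j
        + ∫ n : ℕ, (g (j + m + (n + 1 : ℕ)) - g (j + m + n)) ∂poissonMeasure r := by
      simp only [poissonAverage]
      rw [← integral_add (integrable_poisson_of_bounded r fun n => fd_bounded m hg _)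
        (integrable_poisson_of_bounded r fun n => (abs_sub _ _).trans
          (add_le_add (hg _) (hg _)))]
      congr 1 with n
      simp only [fd]
      rw [show j + (n : ℤ) + m = j + m + n by ring,
        show j + (n : ℤ) + (m + 1 : ℕ) = j + m + (n + 1 : ℕ) by push_cast; ring]
      ring
    rw [hsplit]
    refine (abs_add_le _ _).trans ((add_le_add ih hstep).trans_eq ?_)
    push_cast
    ring

lemma abs_poissonAverage_iterate_fd_le {r : ℝ≥0} (hr : 0 < r) (m k : ℕ) {g : ℤ → ℝ} {M : ℝ}
    (hg : ∀ i, |g i| ≤ M) (j : ℤ) :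
    |poissonAverage (k * r) ((fd m)^[k] g) j| ≤ M * (m / √r) ^ k := by
  induction k generalizing g M with
  | zero =>
    have : poissonAverage 0 g j = g j := by
      simp only [poissonAverage]
      rw [integral_poissonMeasure, tsum_eq_single 0 (fun n hn => by simp [hn])]
      simp
    simpa [this] using hg j
  | succ k ih =>
    rw [Nat.cast_succ, add_one_mul, poissonAverage_add _ _ (iterate_fd_bounded m (k + 1) hg),
      Function.iterate_succ_apply, poissonAverage_iterate_fd r m k (fd_bounded m hg),
      pow_succ', ← mul_assoc]
    exact ih (abs_poissonAverage_fd_le hr m hg)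

lemma integral_translatedPoisson (μr σ2 : ℝ) (g : ℤ → ℝ) :
    ∫ i, g i ∂translatedPoisson μr σ2
      = poissonAverage (Real.toNNReal (σ2 + (μr - σ2 - ⌊μr - σ2⌋))) g ⌊μr - σ2⌋ := by
  rw [translatedPoisson, integral_map .of_discrete .of_discrete]
  rfl

end PoissonSmoothing

open PoissonSmoothing in
/-- `D_{k,m}(TP(μ, σ²)) = O(σ^{−k})` as `σ → ∞`, uniformly in `μ`. -/
theorem Dnm_translatedPoisson_bigO (k m : ℕ) (hk : 0 < k) (hm : 0 < m) :
    ∃ C σ₀ : ℝ, 0 < C ∧ 0 < σ₀ ∧ ∀ σ : ℝ, σ₀ ≤ σ → ∀ μr : ℝ,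
      Dnm k m (translatedPoisson μr (σ ^ 2)) ≤ C / σ ^ k := by
  have hk' : (0 : ℝ) < k := by exact_mod_cast hk
  have hm' : (0 : ℝ) < m := by exact_mod_cast hm
  refine ⟨(m * √k) ^ k, 1, by positivity, one_pos, fun σ hσ μr => ?_⟩
  have hσ0 : 0 < σ := one_pos.trans_le hσ
  refine Real.sSup_le ?_ (by positivity)
  rintro x ⟨g, hg, rfl⟩
  rw [integral_translatedPoisson]
  have hγ : 0 ≤ μr - σ ^ 2 - ⌊μr - σ ^ 2⌋ := sub_nonneg.mpr (Int.floor_le _)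
  set t : ℝ := σ ^ 2 + (μr - σ ^ 2 - ⌊μr - σ ^ 2⌋) with ht
  have hσt : σ ^ 2 ≤ t := by linarith
  have ht0 : 0 < t := by nlinarith
  have hkn : (k : ℝ≥0) ≠ 0 := by exact_mod_cast hk.ne'
  have hr : 0 < t.toNNReal / k := div_pos (Real.toNNReal_pos.mpr ht0) (by exact_mod_cast hk)
  have h := abs_poissonAverage_iterate_fd_le hr m k hg ⌊μr - σ ^ 2⌋
  rw [mul_div_cancel₀ _ hkn, one_mul] at h
  refine h.trans ?_
  rw [← div_pow, NNReal.coe_div, Real.coe_toNNReal _ ht0.le, NNReal.coe_natCast,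
    Real.sqrt_div ht0.le, div_div_eq_mul_div]
  have : σ ≤ √t := Real.le_sqrt_of_sq_le hσt
  gcongr
end
end
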